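/- There is no continuous map V : S² → ℝ³ such that for every q ∈ S², ‖V(q)‖ = 1 and ⟨q, V(q)⟩ = 0. That is, there is no singularity-free continuous unit tangent vector field on the 2-sphere (Hairy Ball Theorem, unit-field form). -/

import Mathlib

open Matrix RealInnerProductSpace

noncomputable section

/-- Euclidean 3-space. -/
abbrev E3 := EuclideanSpace ℝ (Fin 3)

/-- The special orthogonal group SO(3): the subgroup of the real orthogonal group
(3×3 real matrices whose transpose is their inverse) consisting of matrices of
determinant 1. -/
def SO3 : Subgroup (Matrix.unitaryGroup (Fin 3) ℝ) where
  carrier := {A | (A : Matrix (Fin 3) (Fin 3) ℝ).det = 1}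
  one_mem' := by simp
  mul_mem' := by
    intro a b ha hb
    simp only [Set.mem_setOf_eq, Submonoid.coe_mul, Matrix.det_mul] at *
    rw [ha, hb, mul_one]
  inv_mem' := by
    intro a ha
    simp only [Set.mem_setOf_eq] at *
    have h : ((a⁻¹ : Matrix.unitaryGroup (Fin 3) ℝ) : Matrix (Fin 3) (Fin 3) ℝ)
        = star (a : Matrix (Fin 3) (Fin 3) ℝ) := rfl
    rw [h, Matrix.star_eq_conjTranspose, Matrix.det_conjTranspose]
    simp [ha]

/-- The action of an element of SO(3) on Euclidean 3-space, by matrix-vector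
multiplication. -/
def act (g : SO3) (v : E3) : E3 :=
  (EuclideanSpace.equiv (Fin 3) ℝ).symm
    (((g : Matrix.unitaryGroup (Fin 3) ℝ) : Matrix (Fin 3) (Fin 3) ℝ).mulVec
      (EuclideanSpace.equiv (Fin 3) ℝ v))

/-- The north pole p = (0,1,0). -/
def pY : E3 := (EuclideanSpace.equiv (Fin 3) ℝ).symm ![0, 1, 0]

/-- The tangent vector t = (1,0,0). -/
def tX : E3 := (EuclideanSpace.equiv (Fin 3) ℝ).symm ![1, 0, 0]

/-- The set R_Y of rotations about the Y axis, i.e. elements of SO(3) fixing p = (0,1,0). -/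
def RY : Set SO3 := {h | act h pY = pY}

/-- The orbit Ω(g) of g under left multiplication by rotations about the Y axis. -/
def orbit (g : SO3) : Set SO3 := {g' | ∃ h ∈ RY, g' = h * g}

/-- The unit 2-sphere in Euclidean 3-space. -/
def S2 := {q : E3 // ‖q‖ = 1}

instance : TopologicalSpace S2 := instTopologicalSpaceSubtype

instance : CoeOut S2 E3 := ⟨Subtype.val⟩

/-- A nowhere vanishing continuous function on the plane has winding number zero around the unit
circle, so it cannot agree there with `z ↦ -z ^ 2`, whose winding number is two. -/
theorem not_eqOn_unitCircle_neg_sq {f : ℂ → ℂ} (hf : Continuous f) (hf0 : ∀ z, f z ≠ 0) :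
    ¬ ∀ z : ℂ, ‖z‖ = 1 → f z = -z ^ 2 := by
  intro h
  obtain ⟨K, ⟨-, hK⟩, -⟩ := Complex.isCoveringMapOn_exp.existsUnique_continuousMap_lifts
    ⟨f, hf⟩ (Complex.exp_log (hf0 0)) hf0
  have hexp : ∀ z, Complex.exp (K z) = f z := congr_fun hK
  have key := Complex.isCoveringMap_exp.eq_of_comp_eq (A := ℝ)
    (g₁ := fun θ ↦ K (Complex.exp (θ * Complex.I)))
    (g₂ := fun θ ↦ 2 * (θ * Complex.I) + K 1) (by fun_prop) (by fun_prop)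
    (by
      funext θ
      apply Subtype.ext
      have h1 : f 1 = -1 := by simpa using h 1 (by simp)
      simp only [Function.comp_apply, Complex.exp_add, hexp]
      rw [h _ (Complex.norm_exp_ofReal_mul_I θ), h1, ← Complex.exp_nat_mul]
      simp)
    0 (by simp)
  have h2 := congr_fun key (2 * Real.pi)
  simp [Complex.exp_two_pi_mul_I] at h2

/-- Inverse stereographic projection to the unit sphere, from the south pole for `ε = 1` and from
the north pole for `ε = -1`. -/
def invStereo (ε : ℝ) (hε : ε ^ 2 = 1) (z : ℂ) : S2 :=
  ⟨(1 + Complex.normSq z)⁻¹ • !₂[2 * z.re, 2 * z.im, ε * (1 - Complex.normSq z)], by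
    have hs : 0 < 1 + Complex.normSq z := by linarith [Complex.normSq_nonneg z]
    rw [EuclideanSpace.norm_eq, Real.sqrt_eq_one]
    simp only [Fin.sum_univ_three, PiLp.smul_apply, Real.norm_eq_abs, sq_abs, smul_eq_mul]
    simp only [Matrix.cons_val]
    field_simp
    rw [hε, Complex.normSq_apply]
    ring⟩

theorem continuous_invStereo (ε : ℝ) (hε : ε ^ 2 = 1) : Continuous (invStereo ε hε) := by
  have hs : ∀ z : ℂ, 1 + Complex.normSq z ≠ 0 := fun z ↦ by
    linarith [Complex.normSq_nonneg z]
  refine Continuous.subtype_mk (Continuous.smul (Continuous.inv₀ ?_ hs) ?_) _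
  · exact continuous_const.add Complex.continuous_normSq
  · refine (PiLp.continuous_toLp 2 _).comp (continuous_pi fun i ↦ ?_)
    have := Complex.continuous_normSq
    fin_cases i <;> simp <;> fun_prop

theorem inner_invStereo_eq_zero_iff (ε : ℝ) (hε : ε ^ 2 = 1) (z : ℂ) (v : E3) :
    ⟪(invStereo ε hε z : E3), v⟫ = 0 ↔
      2 * z.re * v 0 + 2 * z.im * v 1 + ε * (1 - Complex.normSq z) * v 2 = 0 := by
  have hs : 1 + Complex.normSq z ≠ 0 := by linarith [Complex.normSq_nonneg z]
  rw [invStereo, real_inner_smul_left, mul_eq_zero, or_iff_right (inv_ne_zero hs),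
    PiLp.inner_apply, Fin.sum_univ_three]
  simp [mul_comm]

theorem invStereo_eq_of_normSq_eq_one {ε δ : ℝ} (hε : ε ^ 2 = 1) (hδ : δ ^ 2 = 1) {z : ℂ}
    (hz : Complex.normSq z = 1) : invStereo ε hε z = invStereo δ hδ z := by
  apply Subtype.ext
  simp [invStereo, hz]

/-- The vector `v`, assumed tangent to the sphere at the image of `z` under inverse stereographic
projection with sign `ε`, read in the stereographic chart and suitably rescaled. -/
def chartVec (ε : ℝ) (z : ℂ) (v : E3) : ℂ := ⟨v 0 - ε * v 2 * z.re, v 1 - ε * v 2 * z.im⟩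

theorem continuous_chartVec (ε : ℝ) : Continuous fun p : ℂ × E3 ↦ chartVec ε p.1 p.2 := by
  simp only [chartVec, Complex.mk_eq_add_mul_I]
  fun_prop

theorem chartVec_ne_zero {ε : ℝ} (hε : ε ^ 2 = 1) {z : ℂ} {v : E3}
    (hv : ⟪(invStereo ε hε z : E3), v⟫ = 0) (hv0 : v ≠ 0) : chartVec ε z v ≠ 0 := by
  intro h
  rw [inner_invStereo_eq_zero_iff] at hv
  have h0 : v 0 = ε * v 2 * z.re := sub_eq_zero.mp (congrArg Complex.re h)
  have h1 : v 1 = ε * v 2 * z.im := sub_eq_zero.mp (congrArg Complex.im h)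
  have hs : 1 + Complex.normSq z ≠ 0 := by linarith [Complex.normSq_nonneg z]
  have hεv : ε * v 2 = 0 := by
    have : (ε * v 2) * (1 + Complex.normSq z) = 0 := by
      rw [h0, h1, Complex.normSq_apply] at hv
      rw [Complex.normSq_apply]
      linear_combination hv
    exact (mul_eq_zero.mp this).resolve_right hs
  have h2 : v 2 = 0 := by linear_combination ε * hεv - v 2 * hε
  apply hv0
  ext i
  fin_cases i <;> simp [h0, h1, h2]

theorem chartVec_mul_chartVec_neg {z : ℂ} (hz : Complex.normSq z = 1) {v : E3} (hv1 : ‖v‖ = 1)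
    (hv : z.re * v 0 + z.im * v 1 = 0) : chartVec 1 z v * chartVec (-1) z v = -z ^ 2 := by
  rw [EuclideanSpace.norm_eq, Real.sqrt_eq_one, Fin.sum_univ_three] at hv1
  simp only [Real.norm_eq_abs, sq_abs] at hv1
  rw [Complex.normSq_apply] at hz
  have h0 : v 0 = -(z.re * v 1 - z.im * v 0) * z.im := by
    linear_combination (-v 0) * hz + z.re * hv
  have h1 : v 1 = (z.re * v 1 - z.im * v 0) * z.re := by
    linear_combination (-v 1) * hz + z.im * hv
  generalize z.re * v 1 - z.im * v 0 = t at h0 h1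
  have ht : t ^ 2 + v 2 ^ 2 = 1 := by
    rw [h0, h1] at hv1
    linear_combination hv1 - t ^ 2 * hz
  apply Complex.ext
  · simp only [chartVec, h0, h1, pow_two, Complex.mul_re, Complex.neg_re]
    linear_combination (z.im ^ 2 - z.re ^ 2) * ht
  · simp only [chartVec, h0, h1, pow_two, Complex.mul_im, Complex.neg_im]
    linear_combination (-2 * z.re * z.im) * ht

/-- Hairy Ball Theorem (unit-field form): there is no continuous unit tangent vector field
on the 2-sphere. -/
theorem hairy_ball_no_unit_tangent_field :
    ¬ ∃ V : S2 → E3, Continuous V ∧ ∀ q : S2, ‖V q‖ = 1 ∧ ⟪(q : E3), V q⟫ = 0 := by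
  rintro ⟨V, hV, hq⟩
  have hW : ∀ ε (hε : ε ^ 2 = 1), Continuous fun z ↦ chartVec ε z (V (invStereo ε hε z)) :=
    fun ε hε ↦ (continuous_chartVec ε).comp
      (continuous_id.prodMk (hV.comp (continuous_invStereo ε hε)))
  have hW0 : ∀ ε (hε : ε ^ 2 = 1) z, chartVec ε z (V (invStereo ε hε z)) ≠ 0 := fun ε hε z ↦
    chartVec_ne_zero hε (hq _).2 (norm_ne_zero_iff.mp (by simp [(hq _).1]))
  refine not_eqOn_unitCircle_neg_sq ((hW 1 (by norm_num)).mul (hW (-1) (by norm_num)))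
    (fun z ↦ mul_ne_zero (hW0 _ _ z) (hW0 _ _ z)) fun z hz ↦ ?_
  have hz' : Complex.normSq z = 1 := by rw [Complex.normSq_eq_norm_sq, hz, one_pow]
  have h := (inner_invStereo_eq_zero_iff 1 (by norm_num) z _).mp (hq _).2
  rw [hz'] at h
  rw [Pi.mul_apply, invStereo_eq_of_normSq_eq_one (ε := -1) (δ := 1) (by norm_num) (by norm_num) hz']
  exact chartVec_mul_chartVec_neg hz' (hq _).1 (by linear_combination h / 2)
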